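/- arXiv:1911.01325 — 3 statements merged into one kernel-verified Lean document; each statement's English description precedes it below -/
import Mathlib

section
/- Let μ and ν be Borel probability measures on ℝ with finite second moments, with CDFs F(x) = μ((−∞,x]) and G(x) = ν((−∞,x]) and quantile functions F⁻¹(t) = inf {x : t ≤ F(x)}, G⁻¹(t) = inf {x : t ≤ G(x)} for t ∈ (0,1). Then the infimum, over all couplings π of μ and ν, of ∫_{ℝ×ℝ} (x − y)² dπ(x,y) equals ∫₀¹ (F⁻¹(t) − G⁻¹(t))² dt. -/
open MeasureTheory ProbabilityTheory Set

/-- The cumulative distribution function of a Borel measure on `ℝ`. -/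
noncomputable def cdfOf (μ : Measure ℝ) : ℝ → ℝ := fun x => (μ (Iic x)).toReal

/-- The quantile function (generalized inverse) of a CDF `G`:
`G⁻¹ t = inf {x : ℝ | t ≤ G x}`. -/
noncomputable def quantileFn (G : ℝ → ℝ) : ℝ → ℝ := fun t => sInf {x : ℝ | t ≤ G x}

/-- `π` is a coupling of `μ` and `ν`: its first marginal is `μ` and its second marginal is `ν`. -/
def IsCoupling (π : Measure (ℝ × ℝ)) (μ ν : Measure ℝ) : Prop :=
  π.map Prod.fst = μ ∧ π.map Prod.snd = ν

lemma cdfOf_eq_cdf (μ : Measure ℝ) [IsProbabilityMeasure μ] : cdfOf μ = cdf μ := by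
  funext x
  rw [cdf_eq_real]
  rfl

lemma ofReal_cdfOf (μ : Measure ℝ) [IsProbabilityMeasure μ] (x : ℝ) :
    ENNReal.ofReal (cdfOf μ x) = μ (Iic x) := by
  rw [cdfOf_eq_cdf, ofReal_cdf]

lemma cdfOf_nonneg (μ : Measure ℝ) (x : ℝ) : 0 ≤ cdfOf μ x := ENNReal.toReal_nonneg

lemma cdfOf_le_one (μ : Measure ℝ) [IsProbabilityMeasure μ] (x : ℝ) : cdfOf μ x ≤ 1 := by
  rw [cdfOf_eq_cdf]
  exact cdf_le_one μ x

/-- The Galois connection between a CDF and its quantile function. -/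
lemma quantileFn_cdfOf_le_iff (μ : Measure ℝ) [IsProbabilityMeasure μ] {t : ℝ}
    (ht : t ∈ Ioo (0 : ℝ) 1) (x : ℝ) : quantileFn (cdfOf μ) t ≤ x ↔ t ≤ cdfOf μ x := by
  rw [cdfOf_eq_cdf]
  have hne : {x : ℝ | t ≤ cdf μ x}.Nonempty :=
    ((tendsto_cdf_atTop μ).eventually (eventually_ge_nhds ht.2)).exists
  have hbdd : BddBelow {x : ℝ | t ≤ cdf μ x} := by
    obtain ⟨b, hb⟩ := ((tendsto_cdf_atBot μ).eventually (eventually_lt_nhds ht.1)).exists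
    refine ⟨b, fun y hy => le_of_not_gt fun hyb => ?_⟩
    exact absurd (hy.trans (monotone_cdf μ hyb.le)) (not_le.2 hb)
  refine ⟨fun h => ?_, fun h => csInf_le hbdd h⟩
  have hright : Filter.Tendsto (cdf μ) (nhdsWithin x (Ioi x)) (nhds (cdf μ x)) :=
    ((cdf μ).right_continuous x).mono_left (nhdsWithin_mono _ Ioi_subset_Ici_self)
  refine ge_of_tendsto hright ?_
  filter_upwards [self_mem_nhdsWithin] with y hy
  obtain ⟨z, hz, hzy⟩ := exists_lt_of_csInf_lt hne (lt_of_le_of_lt h hy)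
  exact le_trans hz (monotone_cdf μ hzy.le)

lemma aemeasurable_quantileFn_cdfOf (μ : Measure ℝ) [IsProbabilityMeasure μ] :
    AEMeasurable (quantileFn (cdfOf μ)) (volume.restrict (Ioo 0 1)) := by
  refine aemeasurable_restrict_of_monotoneOn measurableSet_Ioo fun s hs t ht hst => ?_
  exact (quantileFn_cdfOf_le_iff μ hs _).2
    (hst.trans ((quantileFn_cdfOf_le_iff μ ht _).1 le_rfl))

lemma volume_restrict_Ioo_Ioc {a b : ℝ} (ha : 0 ≤ a) (hb : b ≤ 1) :
    volume.restrict (Ioo (0 : ℝ) 1) (Ioc a b) = ENNReal.ofReal (b - a) := by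
  rw [Measure.restrict_congr_set Ioo_ae_eq_Ioc, Measure.restrict_apply measurableSet_Ioc,
    inter_eq_left.2 (Ioc_subset_Ioc ha hb), Real.volume_Ioc]

/-- A probability measure is the law of its quantile function under the uniform law. -/
lemma map_quantileFn_cdfOf (μ : Measure ℝ) [IsProbabilityMeasure μ] :
    (volume.restrict (Ioo 0 1)).map (quantileFn (cdfOf μ)) = μ := by
  have : IsFiniteMeasure ((volume.restrict (Ioo (0 : ℝ) 1)).map (quantileFn (cdfOf μ))) :=
    Measure.isFiniteMeasure_map _ _
  refine Measure.ext_of_Iic _ _ fun x => ?_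
  rw [Measure.map_apply_of_aemeasurable (aemeasurable_quantileFn_cdfOf μ) measurableSet_Iic,
    ← ofReal_cdfOf, ← sub_zero (cdfOf μ x),
    ← volume_restrict_Ioo_Ioc le_rfl (cdfOf_le_one μ x)]
  refine measure_congr ?_
  filter_upwards [ae_restrict_mem measurableSet_Ioo] with t ht
  exact propext ((quantileFn_cdfOf_le_iff μ ht x).trans ⟨fun h => ⟨ht.1, h⟩, fun h => h.2⟩)

lemma measure_quantileFn_le_and_lt (μ ν : Measure ℝ) [IsProbabilityMeasure μ]
    [IsProbabilityMeasure ν] (a b : ℝ) :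
    volume.restrict (Ioo 0 1) {t | quantileFn (cdfOf μ) t ≤ a ∧ b < quantileFn (cdfOf ν) t} =
      ENNReal.ofReal (cdfOf μ a - cdfOf ν b) := by
  rw [← volume_restrict_Ioo_Ioc (cdfOf_nonneg ν b) (cdfOf_le_one μ a)]
  refine measure_congr ?_
  filter_upwards [ae_restrict_mem measurableSet_Ioo] with t ht
  refine propext (and_comm.trans (and_congr ?_ (quantileFn_cdfOf_le_iff μ ht a)))
  rw [← not_le, quantileFn_cdfOf_le_iff ν ht, not_le]

/-- The Fréchet lower bound on the mass a joint law gives to an upper-left quadrant. -/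
lemma ofReal_cdfOf_sub_le {Ω : Type*} [MeasurableSpace Ω] {π : Measure Ω} {μ ν : Measure ℝ}
    [IsProbabilityMeasure μ] [IsProbabilityMeasure ν] {f g : Ω → ℝ} (hf : Measurable f)
    (hg : Measurable g) (hμ : π.map f = μ) (hν : π.map g = ν) (a b : ℝ) :
    ENNReal.ofReal (cdfOf μ a - cdfOf ν b) ≤ π {p | f p ≤ a ∧ b < g p} := by
  rw [ENNReal.ofReal_sub _ (cdfOf_nonneg ν b), ofReal_cdfOf, ofReal_cdfOf, tsub_le_iff_right,
    ← hμ, ← hν, Measure.map_apply hf measurableSet_Iic, Measure.map_apply hg measurableSet_Iic]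
  refine (measure_mono fun p hp => ?_).trans (measure_union_le _ _)
  rcases lt_or_ge b (g p) with h | h
  · exact Or.inl ⟨hp, h⟩
  · exact Or.inr h

lemma volume_Ico_prod_Ico (x y : ℝ) :
    volume {s : ℝ × ℝ | x ≤ min s.1 s.2 ∧ max s.1 s.2 < y} =
      ENNReal.ofReal (y - x) * ENNReal.ofReal (y - x) := by
  have : {s : ℝ × ℝ | x ≤ min s.1 s.2 ∧ max s.1 s.2 < y} = Ico x y ×ˢ Ico x y := by
    ext s
    simp only [mem_ofPred_eq, le_min_iff, max_lt_iff, mem_prod, mem_Ico]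
    tauto
  rw [this, Measure.volume_eq_prod, Measure.prod_prod, Real.volume_Ico]

lemma ofReal_sub_sq (x y : ℝ) :
    ENNReal.ofReal ((x - y) ^ 2) =
      volume {s : ℝ × ℝ | x ≤ min s.1 s.2 ∧ max s.1 s.2 < y} +
        volume {s : ℝ × ℝ | y ≤ min s.1 s.2 ∧ max s.1 s.2 < x} := by
  rw [volume_Ico_prod_Ico, volume_Ico_prod_Ico]
  rcases le_total x y with h | h
  · rw [ENNReal.ofReal_of_nonpos (sub_nonpos.2 h), mul_zero, add_zero,
      ← ENNReal.ofReal_mul (sub_nonneg.2 h)]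
    congr 1
    ring
  · rw [ENNReal.ofReal_of_nonpos (sub_nonpos.2 h), mul_zero, zero_add,
      ← ENNReal.ofReal_mul (sub_nonneg.2 h)]
    congr 1
    ring

lemma measurableSet_le_and_lt {Ω : Type*} [MeasurableSpace Ω] {f g h k : Ω → ℝ}
    (hf : Measurable f) (hg : Measurable g) (hh : Measurable h) (hk : Measurable k) :
    MeasurableSet {p | f p ≤ g p ∧ h p < k p} := by
  rw [ofPred_and]
  exact (measurableSet_le hf hg).inter (measurableSet_lt hh hk)

lemma measurableSet_quadrants {f g : ℝ × ℝ → ℝ} (hf : Measurable f) (hg : Measurable g) :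
    MeasurableSet {q : (ℝ × ℝ) × (ℝ × ℝ) |
      f q.1 ≤ min q.2.1 q.2.2 ∧ max q.2.1 q.2.2 < g q.1} :=
  measurableSet_le_and_lt (by fun_prop) (by fun_prop) (by fun_prop) (by fun_prop)

/-- The quadratic transport cost, written through the quadrant masses of the joint law. -/
lemma lintegral_sub_sq (π : Measure (ℝ × ℝ)) [SFinite π] :
    ∫⁻ p, ENNReal.ofReal ((p.1 - p.2) ^ 2) ∂π =
      ∫⁻ s : ℝ × ℝ, (π {p | p.1 ≤ min s.1 s.2 ∧ max s.1 s.2 < p.2} +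
        π {p | p.2 ≤ min s.1 s.2 ∧ max s.1 s.2 < p.1}) := by
  have h₁ := measurableSet_quadrants measurable_fst measurable_snd
  have h₂ := measurableSet_quadrants measurable_snd measurable_fst
  have m₁ : Measurable fun p : ℝ × ℝ =>
      volume {s : ℝ × ℝ | p.1 ≤ min s.1 s.2 ∧ max s.1 s.2 < p.2} :=
    measurable_measure_prodMk_left h₁
  have m₂ : Measurable fun s : ℝ × ℝ => π {p | p.1 ≤ min s.1 s.2 ∧ max s.1 s.2 < p.2} :=
    measurable_measure_prodMk_right h₁
  have e₁ := (Measure.prod_apply (μ := π) (ν := volume) h₁).symm.trans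
    (Measure.prod_apply_symm h₁)
  have e₂ := (Measure.prod_apply (μ := π) (ν := volume) h₂).symm.trans
    (Measure.prod_apply_symm h₂)
  simp_rw [ofReal_sub_sq]
  rw [lintegral_add_left m₁, lintegral_add_left m₂]
  exact congrArg₂ (· + ·) e₁ e₂

lemma IsCoupling.isProbabilityMeasure {π : Measure (ℝ × ℝ)} {μ ν : Measure ℝ}
    [IsProbabilityMeasure μ] (h : IsCoupling π μ ν) :
    IsProbabilityMeasure π := by
  constructor
  rw [← preimage_univ (f := Prod.fst), ← Measure.map_apply measurable_fst MeasurableSet.univ,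
    h.1, measure_univ]

lemma IsCoupling.integrable_sub_sq {π : Measure (ℝ × ℝ)} {μ ν : Measure ℝ}
    (h : IsCoupling π μ ν) (hμ : Integrable (fun x => x ^ 2) μ)
    (hν : Integrable (fun x => x ^ 2) ν) :
    Integrable (fun p : ℝ × ℝ => (p.1 - p.2) ^ 2) π := by
  rw [← h.1] at hμ
  rw [← h.2] at hν
  have h₁ := hμ.comp_measurable measurable_fst
  have h₂ := hν.comp_measurable measurable_snd
  refine ((h₁.add h₂).const_mul 2).mono' (by fun_prop) (Filter.Eventually.of_forall fun p => ?_)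
  simp only [Pi.add_apply, Function.comp_apply]
  rw [Real.norm_of_nonneg (sq_nonneg _)]
  nlinarith [sq_nonneg (p.1 + p.2)]

/-- The comonotone coupling: the joint law of the quantile functions under the uniform law. -/
noncomputable def quantileCoupling (μ ν : Measure ℝ) : Measure (ℝ × ℝ) :=
  (volume.restrict (Ioo 0 1)).map fun t => (quantileFn (cdfOf μ) t, quantileFn (cdfOf ν) t)

section

variable (μ ν : Measure ℝ) [IsProbabilityMeasure μ] [IsProbabilityMeasure ν]

lemma aemeasurable_quantileFn_prodMk :
    AEMeasurable (fun t => (quantileFn (cdfOf μ) t, quantileFn (cdfOf ν) t))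
      (volume.restrict (Ioo 0 1)) :=
  (aemeasurable_quantileFn_cdfOf μ).prodMk (aemeasurable_quantileFn_cdfOf ν)

lemma isCoupling_quantileCoupling : IsCoupling (quantileCoupling μ ν) μ ν := by
  have h := aemeasurable_quantileFn_prodMk μ ν
  constructor
  · rw [quantileCoupling, AEMeasurable.map_map_of_aemeasurable measurable_fst.aemeasurable h]
    exact map_quantileFn_cdfOf μ
  · rw [quantileCoupling, AEMeasurable.map_map_of_aemeasurable measurable_snd.aemeasurable h]
    exact map_quantileFn_cdfOf ν

lemma integral_quantileCoupling :
    ∫ p, (p.1 - p.2) ^ 2 ∂(quantileCoupling μ ν) =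
      ∫ t in (0 : ℝ)..1, (quantileFn (cdfOf μ) t - quantileFn (cdfOf ν) t) ^ 2 := by
  rw [quantileCoupling, integral_map (aemeasurable_quantileFn_prodMk μ ν) (by fun_prop),
    intervalIntegral.integral_of_le zero_le_one, integral_Ioc_eq_integral_Ioo]

lemma quantileCoupling_fst_le_lt_snd (a b : ℝ) :
    quantileCoupling μ ν {p | p.1 ≤ a ∧ b < p.2} =
      ENNReal.ofReal (cdfOf μ a - cdfOf ν b) := by
  rw [quantileCoupling, Measure.map_apply_of_aemeasurable (aemeasurable_quantileFn_prodMk μ ν)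
    (measurableSet_le_and_lt measurable_fst measurable_const measurable_const measurable_snd)]
  exact measure_quantileFn_le_and_lt μ ν a b

lemma quantileCoupling_snd_le_lt_fst (a b : ℝ) :
    quantileCoupling μ ν {p | p.2 ≤ a ∧ b < p.1} =
      ENNReal.ofReal (cdfOf ν a - cdfOf μ b) := by
  rw [quantileCoupling, Measure.map_apply_of_aemeasurable (aemeasurable_quantileFn_prodMk μ ν)
    (measurableSet_le_and_lt measurable_snd measurable_const measurable_const measurable_fst)]
  exact measure_quantileFn_le_and_lt ν μ a b

variable {μ ν}

lemma IsCoupling.lintegral_quantileCoupling_le {π : Measure (ℝ × ℝ)} (h : IsCoupling π μ ν) :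
    ∫⁻ p, ENNReal.ofReal ((p.1 - p.2) ^ 2) ∂(quantileCoupling μ ν) ≤
      ∫⁻ p, ENNReal.ofReal ((p.1 - p.2) ^ 2) ∂π := by
  have := h.isProbabilityMeasure
  have := (isCoupling_quantileCoupling μ ν).isProbabilityMeasure
  rw [lintegral_sub_sq, lintegral_sub_sq]
  refine lintegral_mono fun s => add_le_add ?_ ?_
  · rw [quantileCoupling_fst_le_lt_snd]
    exact ofReal_cdfOf_sub_le measurable_fst measurable_snd h.1 h.2 _ _
  · rw [quantileCoupling_snd_le_lt_fst]
    exact ofReal_cdfOf_sub_le measurable_snd measurable_fst h.2 h.1 _ _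

lemma IsCoupling.integral_quantileCoupling_le {π : Measure (ℝ × ℝ)} (h : IsCoupling π μ ν)
    (hμ : Integrable (fun x => x ^ 2) μ) (hν : Integrable (fun x => x ^ 2) ν) :
    ∫ p, (p.1 - p.2) ^ 2 ∂(quantileCoupling μ ν) ≤ ∫ p, (p.1 - p.2) ^ 2 ∂π := by
  have hnn : ∀ ρ : Measure (ℝ × ℝ), 0 ≤ᵐ[ρ] fun p : ℝ × ℝ => (p.1 - p.2) ^ 2 :=
    fun ρ => Filter.Eventually.of_forall fun p => sq_nonneg _
  rw [integral_eq_lintegral_of_nonneg_ae (hnn _) (by fun_prop),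
    integral_eq_lintegral_of_nonneg_ae (hnn _) (by fun_prop)]
  exact ENNReal.toReal_mono (h.integrable_sub_sq hμ hν).lintegral_lt_top.ne
    h.lintegral_quantileCoupling_le

end

/-- For Borel probability measures `μ, ν` on `ℝ` with finite second moments,
the infimum over all couplings `π` of `∫ (x - y)² dπ` equals
`∫₀¹ (F⁻¹ t - G⁻¹ t)² dt`, where `F⁻¹, G⁻¹` are the quantile functions of `μ, ν`. -/
theorem wasserstein2_sq_eq_integral_quantile_sq
    (μ ν : Measure ℝ) [IsProbabilityMeasure μ] [IsProbabilityMeasure ν]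
    (hμ2 : Integrable (fun x => x ^ 2) μ) (hν2 : Integrable (fun x => x ^ 2) ν) :
    sInf {c : ℝ | ∃ π : Measure (ℝ × ℝ), IsCoupling π μ ν ∧
        c = ∫ p : ℝ × ℝ, (p.1 - p.2) ^ 2 ∂π} =
      ∫ t in (0:ℝ)..1, (quantileFn (cdfOf μ) t - quantileFn (cdfOf ν) t) ^ 2 := by
  rw [← integral_quantileCoupling]
  refine IsLeast.csInf_eq ⟨⟨_, isCoupling_quantileCoupling μ ν, rfl⟩, ?_⟩
  rintro _ ⟨π, hπ, rfl⟩
  exact hπ.integral_quantileCoupling_le hμ2 hν2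
end

section
/- Let μ and ν be Borel probability measures on ℝ with finite second moments, with CDFs F and G and quantile functions F⁻¹, G⁻¹. Let λ denote Lebesgue measure on the interval (0,1). Then the pushforward of λ under the map t ↦ (F⁻¹(t), G⁻¹(t)) is a coupling of μ and ν (i.e., its first marginal is μ and its second marginal is ν), and its transport cost satisfies ∫ (x − y)² d(pushforward) = ∫₀¹ (F⁻¹(t) − G⁻¹(t))² dt. -/
open MeasureTheory ProbabilityTheory Set

/-- The Galois connection between the quantile function and the CDF. -/
lemma quantileFn_cdf_le_iff (μ : Measure ℝ) {t : ℝ} (ht : t ∈ Ioo (0 : ℝ) 1) (x : ℝ) :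
    quantileFn (cdf μ) t ≤ x ↔ t ≤ cdf μ x := by
  obtain ⟨b, hb⟩ := ((tendsto_cdf_atBot μ).eventually_lt_const ht.1).exists
  obtain ⟨a, ha⟩ := ((tendsto_cdf_atTop μ).eventually_const_lt ht.2).exists
  have hbdd : BddBelow {x : ℝ | t ≤ cdf μ x} :=
    ⟨b, fun y hy => le_of_not_gt fun hyb => (hy.trans (monotone_cdf μ hyb.le)).not_gt hb⟩
  refine ⟨fun h => ?_, fun h => csInf_le hbdd h⟩
  refine ge_of_tendsto (((cdf μ).right_continuous x).mono Ioi_subset_Ici_self)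
    (Filter.eventually_of_mem self_mem_nhdsWithin fun y (hy : x < y) => ?_)
  obtain ⟨z, hz, hzy⟩ := exists_lt_of_csInf_lt ⟨a, ha.le⟩ (h.trans_lt hy)
  exact hz.trans (monotone_cdf μ hzy.le)

lemma monotoneOn_quantileFn_cdf (μ : Measure ℝ) :
    MonotoneOn (quantileFn (cdf μ)) (Ioo (0 : ℝ) 1) := fun _ hs _ ht hst =>
  (quantileFn_cdf_le_iff μ hs _).2 (hst.trans ((quantileFn_cdf_le_iff μ ht _).1 le_rfl))

lemma aemeasurable_quantileFn_cdf (μ : Measure ℝ) :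
    AEMeasurable (quantileFn (cdf μ)) (volume.restrict (Ioo (0 : ℝ) 1)) :=
  aemeasurable_restrict_of_monotoneOn measurableSet_Ioo (monotoneOn_quantileFn_cdf μ)

lemma volume_Iic_inter_Ioo_zero_one {c : ℝ} (hc : c ≤ 1) :
    volume (Iic c ∩ Ioo (0 : ℝ) 1) = ENNReal.ofReal c := by
  apply le_antisymm
  · calc volume (Iic c ∩ Ioo (0 : ℝ) 1) ≤ volume (Ioc 0 c) :=
          measure_mono fun t ht => ⟨ht.2.1, ht.1⟩
      _ = ENNReal.ofReal c := by rw [Real.volume_Ioc, sub_zero]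
  · calc ENNReal.ofReal c = volume (Ioo 0 c) := by rw [Real.volume_Ioo, sub_zero]
      _ ≤ volume (Iic c ∩ Ioo (0 : ℝ) 1) :=
          measure_mono fun t ht => ⟨ht.2.le, ht.1, ht.2.trans_le hc⟩

/-- The quantile function pushes the uniform law on `(0,1)` forward to `μ`. -/
lemma map_quantileFn_cdf (μ : Measure ℝ) [IsProbabilityMeasure μ] :
    (volume.restrict (Ioo (0 : ℝ) 1)).map (quantileFn (cdf μ)) = μ := by
  refine Measure.ext_of_Iic _ _ fun x => ?_
  rw [Measure.map_apply_of_aemeasurable (aemeasurable_quantileFn_cdf μ) measurableSet_Iic,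
    Measure.restrict_apply' measurableSet_Ioo, ← ofReal_cdf μ x,
    ← volume_Iic_inter_Ioo_zero_one (cdf_le_one μ x)]
  congr 1
  ext t
  exact and_congr_left fun ht => quantileFn_cdf_le_iff μ ht x

/-- For Borel probability measures `μ, ν` on `ℝ` with finite second moments,
the pushforward of Lebesgue measure on `(0,1)` under `t ↦ (F⁻¹ t, G⁻¹ t)` is a coupling of
`μ` and `ν`, and its transport cost equals `∫₀¹ (F⁻¹ t - G⁻¹ t)² dt`. -/
theorem quantile_coupling_isCoupling_and_cost
    (μ ν : Measure ℝ) [IsProbabilityMeasure μ] [IsProbabilityMeasure ν]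
    (hμ2 : Integrable (fun x => x ^ 2) μ) (hν2 : Integrable (fun x => x ^ 2) ν) :
    IsCoupling
      ((volume.restrict (Ioo (0:ℝ) 1)).map
        (fun t => (quantileFn (cdfOf μ) t, quantileFn (cdfOf ν) t))) μ ν ∧
    ∫ p : ℝ × ℝ, (p.1 - p.2) ^ 2
        ∂((volume.restrict (Ioo (0:ℝ) 1)).map
          (fun t => (quantileFn (cdfOf μ) t, quantileFn (cdfOf ν) t))) =
      ∫ t in (0:ℝ)..1, (quantileFn (cdfOf μ) t - quantileFn (cdfOf ν) t) ^ 2 := by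
  rw [cdfOf_eq_cdf μ, cdfOf_eq_cdf ν]
  have hF := aemeasurable_quantileFn_cdf μ
  have hG := aemeasurable_quantileFn_cdf ν
  refine ⟨⟨?_, ?_⟩, ?_⟩
  · rw [AEMeasurable.map_map_of_aemeasurable measurable_fst.aemeasurable (hF.prodMk hG)]
    exact map_quantileFn_cdf μ
  · rw [AEMeasurable.map_map_of_aemeasurable measurable_snd.aemeasurable (hF.prodMk hG)]
    exact map_quantileFn_cdf ν
  · rw [integral_map (hF.prodMk hG) (by fun_prop),
      intervalIntegral.integral_of_le zero_le_one, integral_Ioc_eq_integral_Ioo]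
end

section
/- Let x₁,…,x_m and y₁,…,y_n be real numbers and let φ : ℝ → ℝ be continuous and strictly increasing. Let P_m, Q_n denote the empirical CDFs of (xᵢ) and (yⱼ), and P'_m, Q'_n the empirical CDFs of (φ(xᵢ)) and (φ(yⱼ)), with Q_n⁻¹, (Q'_n)⁻¹ their quantile functions. Then (mn/(m+n))·∫₀¹ (P'_m((Q'_n)⁻¹(x)) − x)² dx = (mn/(m+n))·∫₀¹ (P_m(Q_n⁻¹(x)) − x)² dx; that is, the Wasserstein two-sample statistic is invariant under strictly increasing continuous transformations of the data. -/
open MeasureTheory ProbabilityTheory Set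

/-- The empirical CDF of the samples `xs : Fin n → ℝ`:
`Fₙ(x) = (1/n) · #{i : xs i ≤ x}`. -/
noncomputable def empCDF {n : ℕ} (xs : Fin n → ℝ) (x : ℝ) : ℝ :=
  (Finset.univ.filter (fun i => xs i ≤ x)).card / n

/-- The Wasserstein two-sample statistic of the samples `xs` (size `m`) and `ys` (size `n`):
`W₂T = (mn/(m+n)) · ∫₀¹ (P_m(Q_n⁻¹(t)) − t)² dt` where `P_m, Q_n` are the empirical CDFs. -/
noncomputable def W2Tstat (m n : ℕ) (xs : Fin m → ℝ) (ys : Fin n → ℝ) : ℝ :=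
  ((m : ℝ) * n / ((m : ℝ) + n)) *
    ∫ t in (0:ℝ)..1, (empCDF xs (quantileFn (empCDF ys) t) - t) ^ 2

/-- Empirical CDFs transform equivariantly under strictly increasing maps. -/
theorem empCDF_comp_strictMono {n : ℕ} (xs : Fin n → ℝ) {φ : ℝ → ℝ} (hφ : StrictMono φ) (x : ℝ) :
    empCDF (fun i => φ (xs i)) (φ x) = empCDF xs x := by
  simp only [empCDF, hφ.le_iff_le]

/-- For `t ∈ (0, 1]`, the infimum defining the empirical quantile is attained at a sample point. -/
theorem exists_isLeast_le_empCDF {n : ℕ} (hn : 0 < n) (ys : Fin n → ℝ) {t : ℝ}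
    (ht : t ∈ Ioc (0 : ℝ) 1) : ∃ j, IsLeast {x : ℝ | t ≤ empCDF ys x} (ys j) := by
  have : Nonempty (Fin n) := ⟨⟨0, hn⟩⟩
  have hn' : (n : ℝ) ≠ 0 := Nat.cast_ne_zero.mpr hn.ne'
  obtain ⟨k, hk⟩ := Finite.exists_max ys
  have hk1 : empCDF ys (ys k) = 1 := by simp [empCDF, hk, hn']
  obtain ⟨j, hj, hmin⟩ := (Finset.univ.filter fun j => t ≤ empCDF ys (ys j)).exists_min_image ys
    ⟨k, by simpa [hk1] using ht.2⟩
  simp only [Finset.mem_filter, Finset.mem_univ, true_and] at hj hmin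
  refine ⟨j, hj, fun x (hx : t ≤ empCDF ys x) => ?_⟩
  have hne : (Finset.univ.filter fun i => ys i ≤ x).Nonempty := by
    by_contra h
    rw [Finset.not_nonempty_iff_eq_empty] at h
    simp only [empCDF, h, Finset.card_empty, Nat.cast_zero, zero_div] at hx
    exact absurd ht.1 hx.not_gt
  obtain ⟨l, hl, hmax⟩ := Finset.exists_max_image _ ys hne
  simp only [Finset.mem_filter, Finset.mem_univ, true_and] at hl hmax
  have heq : empCDF ys (ys l) = empCDF ys x := by
    have : ∀ i, ys i ≤ ys l ↔ ys i ≤ x := fun i => ⟨fun h => h.trans hl, hmax i⟩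
    simp only [empCDF, this]
  exact (hmin l (heq ▸ hx)).trans hl

/-- Empirical quantiles transform equivariantly under strictly increasing maps. -/
theorem quantileFn_empCDF_comp_strictMono {n : ℕ} (hn : 0 < n) (ys : Fin n → ℝ) {φ : ℝ → ℝ}
    (hφ : StrictMono φ) {t : ℝ} (ht : t ∈ Ioc (0 : ℝ) 1) :
    quantileFn (empCDF fun j => φ (ys j)) t = φ (quantileFn (empCDF ys) t) := by
  obtain ⟨j, hj⟩ := exists_isLeast_le_empCDF hn (fun j => φ (ys j)) ht
  have hj' : IsLeast {x : ℝ | t ≤ empCDF ys x} (ys j) := by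
    refine ⟨?_, fun x hx => hφ.le_iff_le.mp (hj.2 ?_)⟩
    · simpa only [mem_ofPred_eq, empCDF_comp_strictMono ys hφ] using hj.1
    · simpa only [mem_ofPred_eq, empCDF_comp_strictMono ys hφ] using hx
  rw [quantileFn, quantileFn, hj.csInf_eq, hj'.csInf_eq]

/-- The Wasserstein two-sample statistic is invariant under strictly
increasing continuous transformations of the data. -/
theorem W2Tstat_strictMono_invariant
    {m n : ℕ} (xs : Fin m → ℝ) (ys : Fin n → ℝ)
    (φ : ℝ → ℝ) (hφcont : Continuous φ) (hφmono : StrictMono φ) :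
    W2Tstat m n (fun i => φ (xs i)) (fun j => φ (ys j)) = W2Tstat m n xs ys := by
  rcases Nat.eq_zero_or_pos n with rfl | hn
  · simp [W2Tstat]
  unfold W2Tstat
  congr 1
  refine intervalIntegral.integral_congr_ae (Filter.Eventually.of_forall fun t ht => ?_)
  rw [uIoc_of_le zero_le_one] at ht
  rw [quantileFn_empCDF_comp_strictMono hn ys hφmono ht, empCDF_comp_strictMono xs hφmono]
end
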